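/- arXiv:1812.01109 — 3 statements merged into one kernel-verified Lean document; each statement's English description precedes it below -/
import Mathlib

section
/- For every nonnegative integer n, t(1,4,4;n) - (1/6)*r_3(8n+9) equals (-1)^((m+1)/2) * m if 8n+9 = m^2 for some positive integer m, and equals 0 otherwise. Here also r_3(8n+9) = 3*N(1,4,4;8n+9). -/
/-- Number of representations of `n` by `a x² + b y² + c z² + d w²` over ℤ. -/
noncomputable def N4 (a b c d n : ℤ) : ℕ :=
  Set.ncard {v : ℤ × ℤ × ℤ × ℤ |
    n = a * v.1 ^ 2 + b * v.2.1 ^ 2 + c * v.2.2.1 ^ 2 + d * v.2.2.2 ^ 2}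

/-- Number of representations of `n` by `a x(x-1)/2 + b y(y-1)/2 + c z(z-1)/2 + d w(w-1)/2`. -/
noncomputable def t4 (a b c d n : ℤ) : ℕ :=
  Set.ncard {v : ℤ × ℤ × ℤ × ℤ |
    2 * n = a * (v.1 * (v.1 - 1)) + b * (v.2.1 * (v.2.1 - 1))
      + c * (v.2.2.1 * (v.2.2.1 - 1)) + d * (v.2.2.2 * (v.2.2.2 - 1))}

/-- Number of representations of `n` by three squares with coefficients. -/
noncomputable def N3 (a b c n : ℤ) : ℕ :=
  Set.ncard {v : ℤ × ℤ × ℤ | n = a * v.1 ^ 2 + b * v.2.1 ^ 2 + c * v.2.2 ^ 2}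

/-- Number of representations of `n` by three triangular-number terms. -/
noncomputable def t3 (a b c n : ℤ) : ℕ :=
  Set.ncard {v : ℤ × ℤ × ℤ |
    2 * n = a * (v.1 * (v.1 - 1)) + b * (v.2.1 * (v.2.1 - 1)) + c * (v.2.2 * (v.2.2 - 1))}

/-- Number of representations as a sum of three squares. -/
noncomputable def r3 (n : ℤ) : ℕ := N3 1 1 1 n


def sg (m : ℤ) : ℤ := if m % 4 = 1 then 1 else -1
def eg (y : ℤ) : ℤ := if y % 2 = 0 then 1 else -1

noncomputable def bx (K : ℤ) : Finset ℤ := Finset.Icc (-K) K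

lemma sq_bd {m T K : ℤ} (h : m ^ 2 ≤ T) (hK : T ≤ K) : m ∈ bx K := by
  unfold bx
  rw [Finset.mem_Icc]
  constructor <;> nlinarith [sq_nonneg (m - 1), sq_nonneg (m + 1), sq_nonneg m]

noncomputable def SS (K T : ℤ) : Finset (ℤ × ℤ × ℤ × ℤ) :=
  (bx K ×ˢ bx K ×ˢ bx K ×ˢ bx K).filter fun v =>
    v.1 % 4 = v.2.1 % 4 ∧ v.1 % 2 = 1 ∧ v.2.2.1 % 2 = v.2.2.2 % 2 ∧
      v.1 ^ 2 + v.2.1 ^ 2 + 4 * v.2.2.1 ^ 2 + 4 * v.2.2.2 ^ 2 = T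

lemma mem_SS {K T : ℤ} (hK : T ≤ K) (m x y z : ℤ) : (m, x, y, z) ∈ SS K T ↔
    m % 4 = x % 4 ∧ m % 2 = 1 ∧ y % 2 = z % 2 ∧
      m ^ 2 + x ^ 2 + 4 * y ^ 2 + 4 * z ^ 2 = T := by
  unfold SS
  simp only [Finset.mem_filter, Finset.mem_product]
  constructor
  · exact fun h => h.2
  · intro h
    have h4 := h.2.2.2
    refine ⟨⟨sq_bd ?_ hK, sq_bd ?_ hK, sq_bd ?_ hK, sq_bd ?_ hK⟩, h⟩ <;>
      nlinarith [sq_nonneg m, sq_nonneg x, sq_nonneg y, sq_nonneg z]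

noncomputable def EE (K T : ℤ) (f : ℤ → ℤ → ℤ → ℤ → ℤ) : ℤ :=
  ∑ v ∈ SS K T, sg (v.1 + 2 * v.2.2.1) * f v.1 v.2.1 v.2.2.1 v.2.2.2

lemma EE_swap {K T : ℤ} (hK : T ≤ K) (f : ℤ → ℤ → ℤ → ℤ → ℤ) :
    EE K T f = EE K T (fun m x y z => f x m y z) := by
  unfold EE
  refine Finset.sum_nbij' (fun v => (v.2.1, v.1, v.2.2.1, v.2.2.2))
    (fun v => (v.2.1, v.1, v.2.2.1, v.2.2.2)) ?_ ?_ ?_ ?_ ?_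
  · rintro ⟨m, x, y, z⟩ h
    rw [mem_SS hK] at h
    dsimp only
    rw [mem_SS hK]
    exact ⟨by omega, by omega, by omega, by linarith⟩
  · rintro ⟨m, x, y, z⟩ h
    rw [mem_SS hK] at h
    dsimp only
    rw [mem_SS hK]
    exact ⟨by omega, by omega, by omega, by linarith⟩
  · rintro ⟨m, x, y, z⟩ h
    rfl
  · rintro ⟨m, x, y, z⟩ h
    rfl
  · rintro ⟨m, x, y, z⟩ h
    rw [mem_SS hK] at h
    have : sg (m + 2 * y) = sg (x + 2 * y) := by
      unfold sg
      have : (m + 2 * y) % 4 = (x + 2 * y) % 4 := by omega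
      rw [this]
    simp [this]

lemma EE_y {K T : ℤ} (hK : T ≤ K) (f : ℤ → ℤ → ℤ → ℤ → ℤ) :
    EE K T f = EE K T (fun m x y z => f m x (-y) z) := by
  unfold EE
  refine Finset.sum_nbij' (fun v => (v.1, v.2.1, -v.2.2.1, v.2.2.2))
    (fun v => (v.1, v.2.1, -v.2.2.1, v.2.2.2)) ?_ ?_ ?_ ?_ ?_
  · rintro ⟨m, x, y, z⟩ h
    rw [mem_SS hK] at h
    dsimp only
    rw [mem_SS hK]
    exact ⟨by omega, by omega, by omega, by linarith⟩
  · rintro ⟨m, x, y, z⟩ h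
    rw [mem_SS hK] at h
    dsimp only
    rw [mem_SS hK]
    exact ⟨by omega, by omega, by omega, by linarith⟩
  · rintro ⟨m, x, y, z⟩ h
    simp
  · rintro ⟨m, x, y, z⟩ h
    simp
  · rintro ⟨m, x, y, z⟩ h
    rw [mem_SS hK] at h
    have : sg (m + 2 * y) = sg (m + 2 * -y) := by
      unfold sg
      have : (m + 2 * y) % 4 = (m + 2 * -y) % 4 := by omega
      rw [this]
    simp [this]

lemma EE_z {K T : ℤ} (hK : T ≤ K) (f : ℤ → ℤ → ℤ → ℤ → ℤ) :
    EE K T f = EE K T (fun m x y z => f m x y (-z)) := by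
  unfold EE
  refine Finset.sum_nbij' (fun v => (v.1, v.2.1, v.2.2.1, -v.2.2.2))
    (fun v => (v.1, v.2.1, v.2.2.1, -v.2.2.2)) ?_ ?_ ?_ ?_ ?_
  · rintro ⟨m, x, y, z⟩ h
    rw [mem_SS hK] at h
    dsimp only
    rw [mem_SS hK]
    exact ⟨by omega, by omega, by omega, by linarith⟩
  · rintro ⟨m, x, y, z⟩ h
    rw [mem_SS hK] at h
    dsimp only
    rw [mem_SS hK]
    exact ⟨by omega, by omega, by omega, by linarith⟩
  · rintro ⟨m, x, y, z⟩ h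
    simp
  · rintro ⟨m, x, y, z⟩ h
    simp
  · rintro ⟨m, x, y, z⟩ h
    simp

lemma rot_mem {K T : ℤ} (hK : T ≤ K) (m x y z : ℤ) (h : (m, x, y, z) ∈ SS K T) :
    ∃ a b c : ℤ, m = a + b ∧ x = a - b ∧ b % 2 = 0 ∧ z = y - 2 * c ∧ a % 2 = 1 ∧
     (m + x) / 2 = a ∧ (m - x) / 4 = b / 2 ∧ (y - z) / 2 = c ∧ ∃ d, b = 2 * d ∧ b / 2 = d := by
  rw [mem_SS hK] at h
  obtain ⟨h1, h2, h3, h4⟩ := h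
  refine ⟨(m + x) / 2, (m - x) / 2, (y - z) / 2, ?_, ?_, ?_, ?_, ?_, ?_, ?_, ?_, (m - x) / 4, ?_, ?_⟩ <;> omega

def rot (v : ℤ × ℤ × ℤ × ℤ) : ℤ × ℤ × ℤ × ℤ :=
  ((v.1 + v.2.1) / 2 + v.2.2.1 + v.2.2.2, (v.1 + v.2.1) / 2 - v.2.2.1 - v.2.2.2,
    (v.1 - v.2.1) / 4 + (v.2.2.1 - v.2.2.2) / 2, (v.1 - v.2.1) / 4 - (v.2.2.1 - v.2.2.2) / 2)

lemma rot_SS {K T : ℤ} (hK : T ≤ K) (v : ℤ × ℤ × ℤ × ℤ) (h : v ∈ SS K T) :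
    rot v ∈ SS K T := by
  obtain ⟨m, x, y, z⟩ := v
  obtain ⟨a, b, c, h1, h2, h3, h4, h5, h6, h7, h8, d, h9, h10⟩ := rot_mem hK m x y z h
  rw [mem_SS hK] at h
  simp only [rot]
  rw [h6, h7, h8, h10, mem_SS hK]
  refine ⟨by omega, by omega, by omega, ?_⟩
  rw [← h.2.2.2, h1, h2, h4, h9]
  ring

lemma rot_rot {K T : ℤ} (hK : T ≤ K) (v : ℤ × ℤ × ℤ × ℤ) (h : v ∈ SS K T) :
    rot (rot v) = v := by
  obtain ⟨m, x, y, z⟩ := v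
  rw [mem_SS hK] at h
  obtain ⟨h1, h2, h3, h4⟩ := h
  simp only [rot, Prod.mk.injEq]
  refine ⟨?_, ?_, ?_, ?_⟩ <;> omega

lemma EE_rot {K T : ℤ} (hK : T ≤ K) :
    8 * EE K T (fun m x y z => m ^ 3) = EE K T (fun m x y z => (m + x + 2 * y + 2 * z) ^ 3) := by
  unfold EE
  rw [Finset.mul_sum]
  refine Finset.sum_nbij' rot rot (rot_SS hK) (rot_SS hK) (rot_rot hK) (rot_rot hK) ?_
  intro v hv
  obtain ⟨m, x, y, z⟩ := v
  rw [mem_SS hK] at hv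
  obtain ⟨h1, h2, h3, h4⟩ := hv
  simp only [rot]
  have e1 : (m + x) / 2 + y + z + 2 * ((m - x) / 4 + (y - z) / 2) = m + 2 * y := by omega
  have e2 : (m + x) / 2 + y + z + ((m + x) / 2 - y - z) + 2 * ((m - x) / 4 + (y - z) / 2)
    + 2 * ((m - x) / 4 - (y - z) / 2) = 2 * m := by omega
  rw [e1, e2]
  ring

lemma EE_main {K T : ℤ} (hK : T ≤ K) :
    EE K T (fun m x y z => m * (m ^ 2 - x ^ 2 - 4 * y ^ 2 - 4 * z ^ 2)) = 0 := by
  have h0 := EE_rot hK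
  have h1 := EE_y hK (fun m x y z => (m + x + 2 * y + 2 * z) ^ 3)
  have h2 := EE_z hK (fun m x y z => (m + x + 2 * y + 2 * z) ^ 3)
  have h3 := EE_z hK (fun m x y z => (m + x + 2 * (-y) + 2 * z) ^ 3)
  have s1 := EE_swap hK (fun m x y z => m ^ 3)
  have s2 := EE_swap hK (fun m x y z => m * x ^ 2)
  have s3 := EE_swap hK (fun m x y z => m * (y ^ 2 + z ^ 2))
  have key : 24 * EE K T (fun m x y z => m * (m ^ 2 - x ^ 2 - 4 * y ^ 2 - 4 * z ^ 2)) =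
      28 * EE K T (fun m x y z => m ^ 3) + 4 * EE K T (fun m x y z => x ^ 3)
      - 12 * EE K T (fun m x y z => m * x ^ 2)
      + 12 * EE K T (fun m x y z => x * m ^ 2)
      - 48 * EE K T (fun m x y z => m * (y ^ 2 + z ^ 2))
      + 48 * EE K T (fun m x y z => x * (y ^ 2 + z ^ 2))
      - EE K T (fun m x y z => (m + x + 2 * y + 2 * z) ^ 3)
      - EE K T (fun m x y z => (m + x + 2 * (-y) + 2 * z) ^ 3)
      - EE K T (fun m x y z => (m + x + 2 * y + 2 * (-z)) ^ 3)
      - EE K T (fun m x y z => (m + x + 2 * (-y) + 2 * (-z)) ^ 3) := by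
    unfold EE
    simp only [Finset.mul_sum, ← Finset.sum_sub_distrib, ← Finset.sum_add_distrib]
    refine Finset.sum_congr rfl fun v _ => ?_
    ring
  linarith

noncomputable def FF (K T : ℤ) : Finset (ℤ × ℤ × ℤ × ℤ) :=
  (bx K ×ˢ bx K ×ˢ bx K ×ˢ bx K).filter fun v =>
    v.1 % 2 = 1 ∧ v.2.1 % 2 = 1 ∧ v.2.2.1 % 2 = v.2.2.2 % 2 ∧
      v.1 ^ 2 + v.2.1 ^ 2 + 4 * v.2.2.1 ^ 2 + 4 * v.2.2.2 ^ 2 = T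

noncomputable def A3 (K M : ℤ) : Finset (ℤ × ℤ × ℤ) :=
  (bx K ×ˢ bx K ×ˢ bx K).filter fun v =>
    v.1 % 2 = 1 ∧ v.2.1 % 2 = v.2.2 % 2 ∧ v.1 ^ 2 + 4 * v.2.1 ^ 2 + 4 * v.2.2 ^ 2 = M

noncomputable def AA (K M : ℤ) : ℤ := ∑ v ∈ A3 K M, eg v.2.1

noncomputable def CC (K M : ℤ) : ℤ :=
  ∑ m ∈ (bx K).filter (fun m => m % 2 = 1 ∧ m ^ 2 = M), sg m * m

lemma FF_sum {K T : ℤ} (hK : T ≤ K) :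
    ∑ v ∈ FF K T, sg (v.1 + 2 * v.2.2.1) *
      (v.1 * (v.1 ^ 2 - v.2.1 ^ 2 - 4 * v.2.2.1 ^ 2 - 4 * v.2.2.2 ^ 2)) = 0 := by
  rw [← Finset.sum_filter_add_sum_filter_not (FF K T) (fun v => v.1 % 4 = v.2.1 % 4)]
  have h1 : (FF K T).filter (fun v => v.1 % 4 = v.2.1 % 4) = SS K T := by
    ext ⟨m, x, y, z⟩
    unfold FF SS
    simp only [Finset.mem_filter]
    constructor
    · rintro ⟨⟨h, h1, h2, h3, h4⟩, h5⟩
      exact ⟨h, h5, h1, h3, h4⟩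
    · rintro ⟨h, h5, h1, h3, h4⟩
      exact ⟨⟨h, h1, by omega, h3, h4⟩, h5⟩
  have h0 := EE_main hK
  have h2 : ∑ v ∈ (FF K T).filter (fun v => ¬ v.1 % 4 = v.2.1 % 4), sg (v.1 + 2 * v.2.2.1) *
      (v.1 * (v.1 ^ 2 - v.2.1 ^ 2 - 4 * v.2.2.1 ^ 2 - 4 * v.2.2.2 ^ 2)) =
      ∑ v ∈ SS K T, sg (v.1 + 2 * v.2.2.1) *
      (v.1 * (v.1 ^ 2 - v.2.1 ^ 2 - 4 * v.2.2.1 ^ 2 - 4 * v.2.2.2 ^ 2)) := by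
    have hb : ∀ x, x ∈ bx K → -x ∈ bx K := by
      intro x hx
      unfold bx at *
      rw [Finset.mem_Icc] at *
      omega
    refine Finset.sum_nbij' (fun v => (v.1, -v.2.1, v.2.2.1, v.2.2.2))
      (fun v => (v.1, -v.2.1, v.2.2.1, v.2.2.2)) ?_ ?_ ?_ ?_ ?_
    · rintro ⟨m, x, y, z⟩ h
      unfold FF at h
      unfold SS
      simp only [Finset.mem_filter, Finset.mem_product] at h ⊢
      obtain ⟨⟨⟨g1, g2, g3, g4⟩, h1, h2, h3, h4⟩, h5⟩ := h
      refine ⟨⟨g1, hb _ g2, g3, g4⟩, by omega, h1, h3, by linarith⟩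
    · rintro ⟨m, x, y, z⟩ h
      unfold FF
      unfold SS at h
      simp only [Finset.mem_filter, Finset.mem_product] at h ⊢
      obtain ⟨⟨g1, g2, g3, g4⟩, h1, h2, h3, h4⟩ := h
      refine ⟨⟨⟨g1, hb _ g2, g3, g4⟩, h2, by omega, h3, by linarith⟩, by omega⟩
    · rintro ⟨m, x, y, z⟩ h
      simp
    · rintro ⟨m, x, y, z⟩ h
      simp
    · rintro ⟨m, x, y, z⟩ h
      simp
  rw [h1, h2]
  unfold EE at h0
  linarith

lemma sg_mul (m y : ℤ) (h : m % 2 = 1) : sg (m + 2 * y) = sg m * eg y := by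
  unfold sg eg
  split_ifs <;> first | rfl | omega

lemma fiberA {K T : ℤ} (hK : T ≤ K) :
    ∑ m ∈ (bx K).filter (fun m => m % 2 = 1), sg m * m * (2 * m ^ 2 - T) * AA K (T - m ^ 2) = 0 := by
  rw [← FF_sum hK]
  unfold AA FF A3
  rw [Finset.sum_filter, Finset.sum_filter, Finset.sum_product]
  refine Finset.sum_congr rfl fun m _ => ?_
  rw [Finset.sum_filter]
  by_cases hm : m % 2 = 1
  · rw [if_pos hm, Finset.mul_sum]
    refine Finset.sum_congr rfl ?_
    rintro ⟨x, y, z⟩ _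
    dsimp only
    by_cases hc : x % 2 = 1 ∧ y % 2 = z % 2 ∧ x ^ 2 + 4 * y ^ 2 + 4 * z ^ 2 = T - m ^ 2
    · rw [if_pos hc, if_pos ⟨hm, hc.1, hc.2.1, by linarith [hc.2.2]⟩, sg_mul _ _ hm]
      have : m ^ 2 - x ^ 2 - 4 * y ^ 2 - 4 * z ^ 2 = 2 * m ^ 2 - T := by linarith [hc.2.2]
      rw [this]
      ring
    · rw [if_neg hc, if_neg, mul_zero]
      rintro ⟨_, h1, h2, h3⟩
      exact hc ⟨h1, h2, by linarith⟩
  · rw [if_neg hm]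
    symm
    refine Finset.sum_eq_zero fun v _ => ?_
    rw [if_neg]
    exact fun h => hm h.1

lemma fiberC (K T : ℤ) :
    ∑ m ∈ (bx K).filter (fun m => m % 2 = 1), sg m * m * (2 * m ^ 2 - T) * CC K (T - m ^ 2) = 0 := by
  have e : ∑ m ∈ (bx K).filter (fun m => m % 2 = 1), sg m * m * (2 * m ^ 2 - T) * CC K (T - m ^ 2)
      = ∑ m ∈ bx K, ∑ x ∈ bx K, if (m % 2 = 1 ∧ x % 2 = 1 ∧ m ^ 2 + x ^ 2 = T) then
        sg m * m * (sg x * x) * (m ^ 2 - x ^ 2) else 0 := by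
    unfold CC
    rw [Finset.sum_filter]
    refine Finset.sum_congr rfl fun m _ => ?_
    rw [Finset.sum_filter]
    by_cases hm : m % 2 = 1
    · rw [if_pos hm, Finset.mul_sum]
      refine Finset.sum_congr rfl ?_
      rintro x _
      by_cases hc : x % 2 = 1 ∧ x ^ 2 = T - m ^ 2
      · rw [if_pos hc, if_pos ⟨hm, hc.1, by linarith [hc.2]⟩]
        have : m ^ 2 - x ^ 2 = 2 * m ^ 2 - T := by linarith [hc.2]
        rw [this]
        ring
      · rw [if_neg hc, if_neg, mul_zero]
        rintro ⟨_, h1, h2⟩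
        exact hc ⟨h1, by linarith⟩
    · rw [if_neg hm]
      symm
      refine Finset.sum_eq_zero fun v _ => ?_
      rw [if_neg]
      exact fun h => hm h.1
  have e2 : ∑ m ∈ bx K, ∑ x ∈ bx K, (if (m % 2 = 1 ∧ x % 2 = 1 ∧ m ^ 2 + x ^ 2 = T) then
        sg m * m * (sg x * x) * (m ^ 2 - x ^ 2) else 0) =
      - ∑ m ∈ bx K, ∑ x ∈ bx K, (if (m % 2 = 1 ∧ x % 2 = 1 ∧ m ^ 2 + x ^ 2 = T) then
        sg m * m * (sg x * x) * (m ^ 2 - x ^ 2) else 0) := by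
    conv_lhs => rw [Finset.sum_comm]
    rw [← Finset.sum_neg_distrib]
    refine Finset.sum_congr rfl fun m _ => ?_
    rw [← Finset.sum_neg_distrib]
    refine Finset.sum_congr rfl fun x _ => ?_
    by_cases hc : m % 2 = 1 ∧ x % 2 = 1 ∧ m ^ 2 + x ^ 2 = T
    · rw [if_pos hc, if_pos ⟨hc.2.1, hc.1, by linarith [hc.2.2]⟩]
      ring
    · rw [if_neg hc, if_neg, neg_zero]
      rintro ⟨h1, h2, h3⟩
      exact hc ⟨h2, h1, by linarith⟩
  rw [e]
  linarith

lemma odd_sq_ge {m : ℤ} (h : m % 2 = 1) : m = 1 ∨ m = -1 ∨ 9 ≤ m ^ 2 := by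
  by_cases h1 : m = 1
  · exact Or.inl h1
  by_cases h2 : m = -1
  · exact Or.inr (Or.inl h2)
  right; right
  have : 3 ≤ m ∨ m ≤ -3 := by omega
  rcases this with h | h <;> nlinarith

lemma AA_nonpos {K M : ℤ} (h : M ≤ 0) : AA K M = 0 := by
  unfold AA
  refine Finset.sum_eq_zero ?_
  rintro ⟨x, y, z⟩ hv
  unfold A3 at hv
  simp only [Finset.mem_filter] at hv
  exfalso
  rcases odd_sq_ge hv.2.1 with h1 | h1 | h1
  · subst h1; nlinarith [hv.2.2.2, sq_nonneg y, sq_nonneg z]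
  · subst h1; nlinarith [hv.2.2.2, sq_nonneg y, sq_nonneg z]
  · nlinarith [hv.2.2.2, sq_nonneg y, sq_nonneg z]

lemma CC_nonpos {K M : ℤ} (h : M ≤ 0) : CC K M = 0 := by
  unfold CC
  refine Finset.sum_eq_zero ?_
  rintro x hv
  simp only [Finset.mem_filter] at hv
  exfalso
  rcases odd_sq_ge hv.2.1 with h1 | h1 | h1
  · subst h1; nlinarith [hv.2.2]
  · subst h1; nlinarith [hv.2.2]
  · nlinarith [hv.2.2]

lemma CC_sq {K m : ℤ} (hm : 0 < m) (ho : m % 2 = 1) (hK : m ^ 2 ≤ K) :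
    CC K (m ^ 2) = 2 * sg m * m := by
  unfold CC
  have : (bx K).filter (fun x => x % 2 = 1 ∧ x ^ 2 = m ^ 2) = {m, -m} := by
    ext x
    simp only [Finset.mem_filter, Finset.mem_insert, Finset.mem_singleton]
    constructor
    · rintro ⟨_, _, h⟩
      exact sq_eq_sq_iff_eq_or_eq_neg.mp h
    · rintro (rfl | rfl)
      · exact ⟨sq_bd le_rfl hK, ho, rfl⟩
      · exact ⟨sq_bd (by rw [neg_sq]) hK, by omega, by ring⟩
  rw [this, Finset.sum_pair (by omega)]
  have : sg (-m) = - sg m := by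
    unfold sg
    split_ifs <;> first | rfl | omega
  rw [this]
  ring

lemma AA_one {K : ℤ} (hK : 1 ≤ K) : AA K 1 = 2 := by
  unfold AA
  have : A3 K 1 = {(1, 0, 0), (-1, 0, 0)} := by
    ext ⟨x, y, z⟩
    unfold A3
    simp only [Finset.mem_filter, Finset.mem_insert, Finset.mem_singleton, Finset.mem_product,
      Prod.mk.injEq]
    constructor
    · rintro ⟨_, h1, h2, h3⟩
      have hy : y ^ 2 ≤ 0 := by
        rcases odd_sq_ge h1 with h | h | h
        · subst h; nlinarith [sq_nonneg z]
        · subst h; nlinarith [sq_nonneg z]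
        · nlinarith [sq_nonneg z, sq_nonneg y]
      have hz : z ^ 2 ≤ 0 := by
        rcases odd_sq_ge h1 with h | h | h
        · subst h; nlinarith [sq_nonneg y]
        · subst h; nlinarith [sq_nonneg y]
        · nlinarith [sq_nonneg z, sq_nonneg y]
      have hy0 : y = 0 := by nlinarith
      have hz0 : z = 0 := by nlinarith
      subst hy0 hz0
      rcases odd_sq_ge h1 with h | h | h
      · simp [h]
      · simp [h]
      · omega
    · rintro (⟨rfl, rfl, rfl⟩ | ⟨rfl, rfl, rfl⟩)
      · refine ⟨⟨sq_bd (T := 1) (by norm_num) hK, sq_bd (T := 1) (by norm_num) hK, sq_bd (T := 1) (by norm_num) hK⟩, by norm_num, by norm_num, by norm_num⟩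
      · refine ⟨⟨sq_bd (T := 1) (by norm_num) hK, sq_bd (T := 1) (by norm_num) hK, sq_bd (T := 1) (by norm_num) hK⟩, by norm_num, by norm_num, by norm_num⟩
  rw [this, Finset.sum_pair (by simp)]
  rfl

lemma AA_eq_CC_nat (K : ℤ) (N : ℕ) : ((N : ℤ) + 1 ≤ K) → AA K N = CC K N := by
  induction N using Nat.strong_induction_on with
  | _ N ih =>
  intro hK
  rcases Nat.lt_trichotomy N 1 with h | h | h
  · rw [AA_nonpos (by omega), CC_nonpos (by omega)]
  · subst h
    have := CC_sq (K := K) (m := 1) (by norm_num) (by norm_num) (by norm_num; omega)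
    norm_num at this
    rw [Nat.cast_one, AA_one (by omega), this]
    rfl
  · have hA := fiberA hK
    have hC := fiberC K ((N : ℤ) + 1)
    have hD : ∑ m ∈ (bx K).filter (fun m => m % 2 = 1),
        sg m * m * (2 * m ^ 2 - ((N : ℤ) + 1)) *
          (AA K ((N : ℤ) + 1 - m ^ 2) - CC K ((N : ℤ) + 1 - m ^ 2)) = 0 := by
      simp only [mul_sub, Finset.sum_sub_distrib] at hA hC ⊢
      linarith
    have hsub : ({1, -1} : Finset ℤ) ⊆ (bx K).filter (fun m => m % 2 = 1) := by
      intro x hx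
      simp only [Finset.mem_insert, Finset.mem_singleton] at hx
      rw [Finset.mem_filter]
      rcases hx with rfl | rfl
      · exact ⟨sq_bd (T := 1) (by norm_num) (by omega), by norm_num⟩
      · exact ⟨sq_bd (T := 1) (by norm_num) (by omega), by norm_num⟩
    rw [← Finset.sum_subset hsub, Finset.sum_pair (by norm_num)] at hD
    · have e1 : sg 1 = 1 := rfl
      have e2 : sg (-1) = -1 := rfl
      rw [e1, e2] at hD
      norm_num at hD
      rcases hD with h1 | h1
      · omega
      · linarith
    · intro m hm hm1
      simp only [Finset.mem_insert, Finset.mem_singleton, not_or] at hm1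
      rw [Finset.mem_filter] at hm
      have h9 : 9 ≤ m ^ 2 := by
        rcases odd_sq_ge hm.2 with h | h | h
        · exact absurd h hm1.1
        · exact absurd h hm1.2
        · exact h
      by_cases h0 : (N : ℤ) + 1 - m ^ 2 ≤ 0
      · rw [AA_nonpos h0, CC_nonpos h0]; ring
      · obtain ⟨k, hk⟩ := Int.eq_ofNat_of_zero_le (a := (N : ℤ) + 1 - m ^ 2) (by omega)
        rw [hk, ih k (by omega) (by omega)]; ring

lemma par (x : ℤ) : (x % 2 = 1 ∧ x ^ 2 % 8 = 1) ∨ (x % 2 = 0 ∧ x ^ 2 % 4 = 0) := by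
  have h : x % 8 = 0 ∨ x % 8 = 1 ∨ x % 8 = 2 ∨ x % 8 = 3 ∨ x % 8 = 4 ∨ x % 8 = 5 ∨
    x % 8 = 6 ∨ x % 8 = 7 := by omega
  have e : x ^ 2 % 8 = (x % 8) ^ 2 % 8 := by rw [pow_two, pow_two, Int.mul_emod]
  rcases h with h | h | h | h | h | h | h | h <;> rw [h] at e <;> norm_num at e <;> omega

lemma mem_A3 {K M : ℤ} (hK : M ≤ K) (h8 : M % 8 = 1) (x y z : ℤ) :
    (x, y, z) ∈ A3 K M ↔ M = x ^ 2 + 4 * y ^ 2 + 4 * z ^ 2 := by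
  unfold A3
  simp only [Finset.mem_filter, Finset.mem_product]
  constructor
  · rintro ⟨_, _, _, h⟩
    exact h.symm
  · intro h
    have p1 := par x
    have p2 := par y
    have p3 := par z
    refine ⟨⟨sq_bd ?_ hK, sq_bd ?_ hK, sq_bd ?_ hK⟩, by omega, by omega, h.symm⟩ <;>
      nlinarith [sq_nonneg x, sq_nonneg y, sq_nonneg z]

lemma N3_eq {K M : ℤ} (hK : M ≤ K) (h8 : M % 8 = 1) : N3 1 4 4 M = (A3 K M).card := by
  unfold N3
  rw [← Set.ncard_coe_finset]
  congr 1
  ext ⟨x, y, z⟩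
  rw [Finset.mem_coe, mem_A3 hK h8]
  simp

lemma t3_eq {K n : ℤ} (hK : 8 * n + 9 ≤ K) :
    t3 1 4 4 n = ((A3 K (8 * n + 9)).filter fun v => v.2.1 % 2 = 1).card := by
  unfold t3
  rw [← Set.ncard_coe_finset]
  have hinj : Function.Injective
      (fun v : ℤ × ℤ × ℤ => (2 * v.1 - 1, 2 * v.2.1 - 1, 2 * v.2.2 - 1)) := by
    rintro ⟨a, b, c⟩ ⟨a', b', c'⟩ h
    simp only [Prod.mk.injEq] at h ⊢
    omega
  rw [← Set.ncard_image_of_injective _ hinj]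
  congr 1
  ext ⟨x, y, z⟩
  rw [Finset.mem_coe, Finset.mem_filter, mem_A3 hK (by omega)]
  simp only [Set.mem_image, Set.mem_setOf_eq, Prod.exists, Prod.mk.injEq]
  constructor
  · rintro ⟨a, b, c, h, rfl, rfl, rfl⟩
    exact ⟨by linarith, by omega⟩
  · rintro ⟨h, hy⟩
    have p1 := par x
    have p2 := par y
    have p3 := par z
    obtain ⟨a, rfl⟩ : ∃ a, x = 2 * a - 1 := ⟨(x + 1) / 2, by omega⟩
    obtain ⟨b, rfl⟩ : ∃ a, y = 2 * a - 1 := ⟨(y + 1) / 2, by omega⟩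
    obtain ⟨c, rfl⟩ : ∃ a, z = 2 * a - 1 := ⟨(z + 1) / 2, by omega⟩
    exact ⟨a, b, c, by linarith, rfl, rfl, rfl⟩

lemma AA_card (K M : ℤ) :
    AA K M = (A3 K M).card - 2 * ((A3 K M).filter fun v => v.2.1 % 2 = 1).card := by
  unfold AA
  rw [Finset.card_eq_sum_ones, Finset.card_filter]
  push_cast
  rw [Finset.mul_sum, ← Finset.sum_sub_distrib]
  refine Finset.sum_congr rfl fun v _ => ?_
  unfold eg
  split_ifs <;> first | rfl | omega

lemma r3_eq {K M : ℤ} (hK : M ≤ K) (h8 : M % 8 = 1) : r3 M = 3 * (A3 K M).card := by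
  unfold r3 N3
  have i1 : Function.Injective (fun v : ℤ × ℤ × ℤ => (v.1, 2 * v.2.1, 2 * v.2.2)) := by
    rintro ⟨a, b, c⟩ ⟨a', b', c'⟩ h
    simp only [Prod.mk.injEq] at h ⊢
    omega
  have i2 : Function.Injective (fun v : ℤ × ℤ × ℤ => (2 * v.2.1, v.1, 2 * v.2.2)) := by
    rintro ⟨a, b, c⟩ ⟨a', b', c'⟩ h
    simp only [Prod.mk.injEq] at h ⊢
    omega
  have i3 : Function.Injective (fun v : ℤ × ℤ × ℤ => (2 * v.2.1, 2 * v.2.2, v.1)) := by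
    rintro ⟨a, b, c⟩ ⟨a', b', c'⟩ h
    simp only [Prod.mk.injEq] at h ⊢
    omega
  have hodd : ∀ x y z : ℤ, M = x ^ 2 + 4 * y ^ 2 + 4 * z ^ 2 → x % 2 = 1 := by
    intro x y z h
    have p1 := par x
    omega
  have hset : {v : ℤ × ℤ × ℤ | M = 1 * v.1 ^ 2 + 1 * v.2.1 ^ 2 + 1 * v.2.2 ^ 2} =
      (((A3 K M).image (fun v : ℤ × ℤ × ℤ => (v.1, 2 * v.2.1, 2 * v.2.2)) ∪
       (A3 K M).image (fun v : ℤ × ℤ × ℤ => (2 * v.2.1, v.1, 2 * v.2.2)) ∪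
       (A3 K M).image (fun v : ℤ × ℤ × ℤ => (2 * v.2.1, 2 * v.2.2, v.1)) : Finset _) : Set _) := by
    ext ⟨x, y, z⟩
    simp only [Finset.coe_union, Finset.coe_image, Set.mem_union, Set.mem_image, Finset.mem_coe,
      Set.mem_setOf_eq, Prod.exists, mem_A3 hK h8, Prod.mk.injEq]
    constructor
    · intro h
      have p1 := par x
      have p2 := par y
      have p3 := par z
      have : (x % 2 = 1 ∧ y % 2 = 0 ∧ z % 2 = 0) ∨ (x % 2 = 0 ∧ y % 2 = 1 ∧ z % 2 = 0) ∨
        (x % 2 = 0 ∧ y % 2 = 0 ∧ z % 2 = 1) := by omega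
      rcases this with ⟨h1, h2, h3⟩ | ⟨h1, h2, h3⟩ | ⟨h1, h2, h3⟩
      · obtain ⟨b, rfl⟩ : ∃ a, y = 2 * a := ⟨y / 2, by omega⟩
        obtain ⟨c, rfl⟩ : ∃ a, z = 2 * a := ⟨z / 2, by omega⟩
        exact Or.inl (Or.inl ⟨x, b, c, by linarith, rfl, rfl, rfl⟩)
      · obtain ⟨b, rfl⟩ : ∃ a, x = 2 * a := ⟨x / 2, by omega⟩
        obtain ⟨c, rfl⟩ : ∃ a, z = 2 * a := ⟨z / 2, by omega⟩
        exact Or.inl (Or.inr ⟨y, b, c, by linarith, rfl, rfl, rfl⟩)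
      · obtain ⟨b, rfl⟩ : ∃ a, x = 2 * a := ⟨x / 2, by omega⟩
        obtain ⟨c, rfl⟩ : ∃ a, y = 2 * a := ⟨y / 2, by omega⟩
        exact Or.inr ⟨z, b, c, by linarith, rfl, rfl, rfl⟩
    · rintro ((⟨a, b, c, h, rfl, rfl, rfl⟩ | ⟨a, b, c, h, rfl, rfl, rfl⟩) |
        ⟨a, b, c, h, rfl, rfl, rfl⟩) <;> linarith
  rw [hset, Set.ncard_coe_finset, Finset.card_union_of_disjoint, Finset.card_union_of_disjoint,
    Finset.card_image_of_injective _ i1, Finset.card_image_of_injective _ i2,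
    Finset.card_image_of_injective _ i3]
  · ring
  · rw [Finset.disjoint_left]
    rintro ⟨x, y, z⟩ h1 h2
    simp only [Finset.mem_image, Prod.exists, mem_A3 hK h8, Prod.mk.injEq] at h1 h2
    obtain ⟨a, b, c, h, g1, g2, g3⟩ := h1
    obtain ⟨a', b', c', h', g1', g2', g3'⟩ := h2
    have := hodd _ _ _ h
    omega
  · rw [Finset.disjoint_left]
    rintro ⟨x, y, z⟩ h1 h2
    simp only [Finset.mem_union, Finset.mem_image, Prod.exists, mem_A3 hK h8, Prod.mk.injEq] at h1 h2
    obtain ⟨a', b', c', h', g1', g2', g3'⟩ := h2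
    rcases h1 with ⟨a, b, c, h, g1, g2, g3⟩ | ⟨a, b, c, h, g1, g2, g3⟩
    · have := hodd _ _ _ h
      omega
    · have := hodd _ _ _ h
      omega

theorem stmt8 (n : ℤ) (hn : 0 ≤ n) :
    (∀ m : ℤ, 0 < m → 8*n + 9 = m^2 →
      (6 * t3 1 4 4 n : ℤ) - r3 (8*n + 9) = 6 * (-1) ^ (((m + 1) / 2).toNat) * m) ∧
    ((¬ ∃ m : ℤ, 0 < m ∧ 8*n + 9 = m^2) →
      (6 * t3 1 4 4 n : ℤ) = r3 (8*n + 9)) ∧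
    r3 (8*n + 9) = 3 * N3 1 4 4 (8*n + 9) := by
  obtain ⟨K, hKd⟩ : ∃ K, K = 8 * n + 9 + 1 := ⟨_, rfl⟩
  have hK : 8 * n + 9 ≤ K := by omega
  have h8 : (8 * n + 9) % 8 = 1 := by omega
  have hN := N3_eq hK h8
  have ht := t3_eq hK
  have hr := r3_eq hK h8
  have hA := AA_card K (8 * n + 9)
  have hAC : AA K (8 * n + 9) = CC K (8 * n + 9) := by
    have := AA_eq_CC_nat K (8 * n + 9).toNat
    rw [Int.toNat_of_nonneg (by omega)] at this
    exact this (by omega)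
  have hmain : (6 * t3 1 4 4 n : ℤ) - r3 (8*n + 9) = -3 * CC K (8 * n + 9) := by
    rw [← hAC, hA, ht, hr]
    push_cast
    ring
  refine ⟨?_, ?_, by rw [hr, hN]⟩
  · intro m hm hsq
    have hp := par m
    have ho : m % 2 = 1 := by omega
    rw [hmain, hsq, CC_sq hm ho (by omega)]
    have : (-1 : ℤ) ^ (((m + 1) / 2).toNat) = - sg m := by
      unfold sg
      split_ifs with h
      · rw [Odd.neg_one_pow]
        rw [Nat.odd_iff]
        omega
      · rw [Even.neg_one_pow]
        · ring
        · rw [Nat.even_iff]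
          omega
    rw [this]
    ring
  · intro hno
    have : CC K (8 * n + 9) = 0 := by
      unfold CC
      refine Finset.sum_eq_zero ?_
      intro x hx
      rw [Finset.mem_filter] at hx
      exfalso
      apply hno
      refine ⟨|x|, abs_pos.mpr ?_, by rw [sq_abs]; exact hx.2.2.symm⟩
      rintro rfl
      omega
    rw [this] at hmain
    linarith
end

section
/- For positive integers a, b with a odd, and any nonnegative integer n: t(a,a,6a,8b; 8n+6a) = 4*t(2a,2a,3a,b;n), t(a,a,6a,8b; 8n+4a) = 2*t(a,a,3a,b;n), t(2a,3a,3a,8b; 8n+12a) = 4*t(a,6a,6a,b;n), and t(2a,3a,3a,8b; 8n+6a) = 2*t(a,3a,3a,b;n). -/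
lemma half_aux {α : Type*} (A : Set α) (σ : α → α) (P : α → Prop) (hσ : ∀ x, σ (σ x) = x)
    (hA : ∀ x ∈ A, σ x ∈ A) (hP : ∀ x ∈ A, (P (σ x) ↔ ¬ P x)) :
    A.ncard = 2 * {x | x ∈ A ∧ P x}.ncard := by
  classical
  let f : {x | x ∈ A ∧ P x} × Bool → A := fun p =>
    if p.2 then ⟨p.1.1, p.1.2.1⟩ else ⟨σ p.1.1, hA _ p.1.2.1⟩
  have hf : Function.Bijective f := by
    constructor
    · rintro ⟨⟨x, hx, px⟩, s⟩ ⟨⟨y, hy, py⟩, t⟩ h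
      have h' := congrArg Subtype.val h
      cases s <;> cases t <;> simp [f] at h' ⊢
      · rw [← hσ x, h', hσ]
      · subst h'; exact (hP x hx).1 py px
      · subst h'; exact (hP y hy).1 px py
      · exact h'
    · rintro ⟨x, hx⟩
      by_cases px : P x
      · exact ⟨⟨⟨x, hx, px⟩, true⟩, by simp [f]⟩
      · exact ⟨⟨⟨σ x, hA x hx, (hP x hx).2 px⟩, false⟩, by simp [f, hσ]⟩
  have h := Nat.card_congr (Equiv.ofBijective f hf)
  rw [Nat.card_prod, Nat.card_eq_fintype_card (α := Bool), Fintype.card_bool] at h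
  change Nat.card A = 2 * Nat.card {x | x ∈ A ∧ P x}
  omega

lemma param_aux {α β : Type*} (S T : Set α) (f g : β → α)
    (hf : Function.Injective f) (hg : Function.Injective g)
    (h : ∀ r, f r ∈ S ↔ g r ∈ T) (hS : ∀ s ∈ S, ∃ r, f r = s) (hT : ∀ s ∈ T, ∃ r, g r = s) :
    S.ncard = T.ncard := by
  have e1 : S = f '' {r | f r ∈ S} := by
    ext s; constructor
    · intro hs; obtain ⟨r, rfl⟩ := hS s hs; exact ⟨r, hs, rfl⟩
    · rintro ⟨r, hr, rfl⟩; exact hr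
  have e2 : T = g '' {r | f r ∈ S} := by
    ext s; constructor
    · intro hs; obtain ⟨r, rfl⟩ := hT s hs; exact ⟨r, (h r).2 hs, rfl⟩
    · rintro ⟨r, hr, rfl⟩; exact (h r).1 hr
  rw [e1, Set.ncard_image_of_injective _ hf]
  conv_rhs => rw [e2, Set.ncard_image_of_injective _ hg]

/-- reduction of the set with equal coefficients in the first two slots -/
lemma red12 (a c d n : ℤ) : t4 a a c d n = 4 * Set.ncard {v : ℤ × ℤ × ℤ × ℤ |
    2 * n = a * (v.1 * (v.1 - 1)) + a * (v.2.1 * (v.2.1 - 1))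
      + c * (v.2.2.1 * (v.2.2.1 - 1)) + d * (v.2.2.2 * (v.2.2.2 - 1))
      ∧ (v.1 + v.2.1 - 2 * v.2.2.1) % 4 = 0} := by
  unfold t4
  rw [half_aux _ (fun v => (v.1, 1 - v.2.1, v.2.2.1, v.2.2.2)) (fun v => (v.1 + v.2.1) % 2 = 0),
    half_aux {x | x ∈ _ ∧ _} (fun v => (v.1, v.2.1, 1 - v.2.2.1, v.2.2.2))
      (fun v => (v.1 + v.2.1 - 2 * v.2.2.1) % 4 = 0), ← mul_assoc]
  · norm_num
    congr 1; ext ⟨x, y, z, w⟩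
    simp only [Set.mem_ofPred_eq]
    constructor
    · rintro ⟨⟨h, -⟩, h2⟩; exact ⟨h, h2⟩
    · rintro ⟨h, h2⟩; exact ⟨⟨h, by omega⟩, h2⟩
  · rintro ⟨x, y, z, w⟩; simp
  · rintro ⟨x, y, z, w⟩ ⟨h, h2⟩
    simp only [Set.mem_ofPred_eq] at *
    exact ⟨by rw [h]; ring, h2⟩
  · rintro ⟨x, y, z, w⟩ ⟨h, h2⟩
    simp only at *
    omega
  · rintro ⟨x, y, z, w⟩; simp
  · rintro ⟨x, y, z, w⟩ h
    simp only [Set.mem_ofPred_eq] at *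
    rw [h]; ring
  · rintro ⟨x, y, z, w⟩ h
    simp only at *
    omega

lemma rotate (a c d n : ℤ) : t4 c a a d n = t4 a a c d n := by
  unfold t4
  apply param_aux _ _ (fun v : ℤ × ℤ × ℤ × ℤ => (v.2.2.1, v.1, v.2.1, v.2.2.2)) id
  · rintro ⟨x, y, z, w⟩ ⟨x', y', z', w'⟩ h
    simp at h ⊢; tauto
  · exact fun _ _ h => h
  · rintro ⟨x, y, z, w⟩
    simp only [Set.mem_ofPred_eq, id]
    constructor <;> intro h <;> rw [h] <;> ring
  · rintro ⟨x, y, z, w⟩ _; exact ⟨(y, z, x, w), rfl⟩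
  · rintro s _; exact ⟨s, rfl⟩

/-- halving in the second and third slots -/
lemma red23 (a b c d n : ℤ) : t4 a b c d n = 2 * Set.ncard {v : ℤ × ℤ × ℤ × ℤ |
    2 * n = a * (v.1 * (v.1 - 1)) + b * (v.2.1 * (v.2.1 - 1))
      + c * (v.2.2.1 * (v.2.2.1 - 1)) + d * (v.2.2.2 * (v.2.2.2 - 1))
      ∧ (v.2.1 - v.2.2.1) % 2 = 0} := by
  unfold t4
  rw [half_aux _ (fun v => (v.1, v.2.1, 1 - v.2.2.1, v.2.2.2))
    (fun v => (v.2.1 - v.2.2.1) % 2 = 0)]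
  · rfl
  · rintro ⟨x, y, z, w⟩; simp
  · rintro ⟨x, y, z, w⟩ h
    simp only [Set.mem_ofPred_eq] at *
    rw [h]; ring
  · rintro ⟨x, y, z, w⟩ h
    simp only at *
    omega

lemma par_s15 (w : ℤ) : ∃ j, w * (w - 1) = 2 * j := by
  obtain ⟨k, hk⟩ := Int.even_mul_pred_self w
  exact ⟨k, by rw [hk]; ring⟩

lemma sqpar (d : ℤ) : ∃ j, d * d = d + 2 * j := by
  obtain ⟨k, hk⟩ := par_s15 d
  exact ⟨k, by linarith⟩

lemma dvd16 (a b n Q m w : ℤ) (hao : Odd a)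
    (h : 2 * (8 * n + m * a) = a * Q + 8 * b * (w * (w - 1))) : ∃ q, Q = 2 * m + 16 * q := by
  obtain ⟨j, hj⟩ := par_s15 w
  have h1 : (16 : ℤ) ∣ a * (Q - 2 * m) := ⟨n - b * j, by rw [hj] at h; linarith⟩
  have hc : IsCoprime (16 : ℤ) a := by
    obtain ⟨k, rfl⟩ := hao
    have : IsCoprime (2 : ℤ) (2 * k + 1) := ⟨-k, 1, by ring⟩
    simpa using this.pow_left (m := 4)
  obtain ⟨q, hq⟩ := hc.dvd_of_dvd_mul_left h1
  exact ⟨q, by linarith⟩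

lemma case1 (a b n : ℤ) (hao : Odd a) :
    t4 a a (6*a) (8*b) (8*n + 6*a) = 4 * t4 (2*a) (2*a) (3*a) b n := by
  rw [red12]; congr 1
  unfold t4
  apply param_aux _ _ (fun v : ℤ × ℤ × ℤ × ℤ => (3 * v.1 - v.2.1 + 3 * v.2.2.1 - 2,
    3 * v.2.1 - v.1 + 3 * v.2.2.1 - 2, v.1 + v.2.1 - v.2.2.1, v.2.2.2)) id
  · rintro ⟨x, y, z, w⟩ ⟨x', y', z', w'⟩ h
    simp only [Prod.mk.injEq] at h ⊢; omega
  · exact fun _ _ h => h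
  · rintro ⟨x, y, z, w⟩
    simp only [Set.mem_ofPred_eq, id]
    constructor
    · rintro ⟨h, -⟩; linarith
    · intro h; exact ⟨by linarith, by omega⟩
  · rintro ⟨x, y, z, w⟩ ⟨h, h2⟩
    simp only at h h2
    obtain ⟨q, hq⟩ := dvd16 a b n (x*(x-1)+y*(y-1)+6*(z*(z-1))) 6 w hao (by linarith)
    obtain ⟨k, hk⟩ : ∃ k, x + y = 2 * z + 4 * k := ⟨(x + y - 2 * z) / 4, by omega⟩
    obtain ⟨d, hd⟩ : ∃ d, x = z + 2 * k + d := ⟨x - z - 2 * k, by omega⟩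
    obtain rfl : y = z + 2 * k - d := by omega
    subst hd
    obtain ⟨z1, hz1⟩ := par_s15 z
    obtain ⟨d1, hd1⟩ := sqpar d
    have hq2 : 8*(z*(z-1))+8*(k*k)+8*(z*k)+2*(d*d)-4*k = 12 + 16*q := by linarith
    obtain ⟨e, rfl⟩ : ∃ e, d = 2 * e := ⟨d / 2, by omega⟩
    have hq3 : 8*(z*(z-1))+8*(k*k)+8*(z*k)+8*(e*e)-4*k = 12 + 16*q := by linarith
    obtain ⟨j, rfl⟩ : ∃ j, k = 2 * j - 1 := ⟨(k + 1) / 2, by omega⟩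
    obtain ⟨e1, he1⟩ := sqpar e
    have hq4 : 8*(z*(z-1))+8*(4*(j*j)-4*j+1)+16*(z*j)-8*z+8*(e*e)-8*j+4 = 12 + 16*q := by linarith
    have : (z + j + e) % 2 = 0 := by omega
    refine ⟨((z+j+e)/2, (z+j-e)/2, j, w), ?_⟩
    simp only [Prod.mk.injEq, and_true, true_and]
    omega
  · rintro s _; exact ⟨s, rfl⟩

lemma case2 (a b n : ℤ) (hao : Odd a) :
    t4 a a (6*a) (8*b) (8*n + 4*a) = 2 * t4 a a (3*a) b n := by
  rw [red12, red23, ← mul_assoc]; congr 1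
  apply param_aux _ _ (fun v : ℤ × ℤ × ℤ × ℤ => (v.1 + 5 * v.2.1 + 4 * v.2.2.1 - 2,
    v.1 + v.2.1 - 4 * v.2.2.1 + 2, v.1 - v.2.1, v.2.2.2))
    (fun v : ℤ × ℤ × ℤ × ℤ => (v.1, v.2.2.1 + 2 * v.2.1, v.2.2.1, v.2.2.2))
  · rintro ⟨x, y, z, w⟩ ⟨x', y', z', w'⟩ h
    simp only [Prod.mk.injEq] at h ⊢; omega
  · rintro ⟨x, y, z, w⟩ ⟨x', y', z', w'⟩ h
    simp only [Prod.mk.injEq] at h ⊢; omega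
  · rintro ⟨x, y, z, w⟩
    simp only [Set.mem_ofPred_eq]
    constructor
    · rintro ⟨h, -⟩; exact ⟨by linarith, by omega⟩
    · rintro ⟨h, -⟩; exact ⟨by linarith, by omega⟩
  · rintro ⟨x, y, z, w⟩ ⟨h, h2⟩
    simp only at h h2
    obtain ⟨q, hq⟩ := dvd16 a b n (x*(x-1)+y*(y-1)+6*(z*(z-1))) 4 w hao (by linarith)
    obtain ⟨k, hk⟩ : ∃ k, x + y = 2 * z + 4 * k := ⟨(x + y - 2 * z) / 4, by omega⟩
    obtain ⟨d, hd⟩ : ∃ d, x = z + 2 * k + d := ⟨x - z - 2 * k, by omega⟩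
    obtain rfl : y = z + 2 * k - d := by omega
    subst hd
    obtain ⟨z1, hz1⟩ := par_s15 z
    obtain ⟨d1, hd1⟩ := sqpar d
    have hq2 : 8*(z*(z-1))+8*(k*k)+8*(z*k)+2*(d*d)-4*k = 8 + 16*q := by linarith
    obtain ⟨e, rfl⟩ : ∃ e, d = 2 * e := ⟨d / 2, by omega⟩
    have hq3 : 8*(z*(z-1))+8*(k*k)+8*(z*k)+8*(e*e)-4*k = 8 + 16*q := by linarith
    obtain ⟨j, rfl⟩ : ∃ j, k = 2 * j := ⟨k / 2, by omega⟩
    obtain ⟨e1, he1⟩ := sqpar e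
    have hq4 : 8*(z*(z-1))+32*(j*j)+16*(z*j)+8*(e*e)-8*j = 8 + 16*q := by linarith
    have : (j + e) % 2 = 1 := by omega
    refine ⟨(z + j, j, (e - j + 1) / 2, w), ?_⟩
    simp only [Prod.mk.injEq, and_true, true_and]
    omega
  · rintro ⟨x, y, z, w⟩ ⟨h, h2⟩
    simp only at h2
    refine ⟨(x, (y - z) / 2, z, w), ?_⟩
    simp only [Prod.mk.injEq, and_true, true_and]
    omega

/- below the roles are rotated: the source form is `3a, 3a, 2a, 8b` -/
lemma case3 (a b n : ℤ) (hao : Odd a) :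
    t4 (2*a) (3*a) (3*a) (8*b) (8*n + 12*a) = 4 * t4 a (6*a) (6*a) b n := by
  rw [rotate, red12]; congr 1
  unfold t4
  apply param_aux _ _ (fun v : ℤ × ℤ × ℤ × ℤ => (v.1 + v.2.1 - 3 * v.2.2.1 + 1,
    v.1 - 3 * v.2.1 + v.2.2.1 + 1, v.1 + 3 * v.2.1 + 3 * v.2.2.1 - 3, v.2.2.2)) id
  · rintro ⟨x, y, z, w⟩ ⟨x', y', z', w'⟩ h
    simp only [Prod.mk.injEq] at h ⊢; omega
  · exact fun _ _ h => h
  · rintro ⟨x, y, z, w⟩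
    simp only [Set.mem_ofPred_eq, id]
    constructor
    · rintro ⟨h, -⟩; linarith
    · intro h; exact ⟨by linarith, by omega⟩
  · rintro ⟨x, y, z, w⟩ ⟨h, h2⟩
    simp only at h h2
    obtain ⟨q, hq⟩ := dvd16 a b n (3*(x*(x-1))+3*(y*(y-1))+2*(z*(z-1))) 12 w hao (by linarith)
    obtain ⟨k, hk⟩ : ∃ k, x + y = 2 * z + 4 * k := ⟨(x + y - 2 * z) / 4, by omega⟩
    obtain ⟨d, hd⟩ : ∃ d, x = z + 2 * k + d := ⟨x - z - 2 * k, by omega⟩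
    obtain rfl : y = z + 2 * k - d := by omega
    subst hd
    obtain ⟨z1, hz1⟩ := par_s15 z
    obtain ⟨d1, hd1⟩ := sqpar d
    have hq2 : 8*(z*(z-1))+24*(k*k)+24*(z*k)+6*(d*d)-12*k = 24 + 16*q := by linarith
    obtain ⟨e, rfl⟩ : ∃ e, d = 2 * e := ⟨d / 2, by omega⟩
    have hq3 : 8*(z*(z-1))+24*(k*k)+24*(z*k)+24*(e*e)-12*k = 24 + 16*q := by linarith
    obtain ⟨j, rfl⟩ : ∃ j, k = 2 * j := ⟨k / 2, by omega⟩
    obtain ⟨e1, he1⟩ := sqpar e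
    have hq4 : 8*(z*(z-1))+96*(j*j)+48*(z*j)+24*(e*e)-24*j = 24 + 16*q := by linarith
    have : (j + e) % 2 = 1 := by omega
    refine ⟨(z + 3 * j, (e - j + 1) / 2, (1 - j - e) / 2, w), ?_⟩
    simp only [Prod.mk.injEq, and_true, true_and]
    omega
  · rintro s _; exact ⟨s, rfl⟩

lemma case4 (a b n : ℤ) (hao : Odd a) :
    t4 (2*a) (3*a) (3*a) (8*b) (8*n + 6*a) = 2 * t4 a (3*a) (3*a) b n := by
  rw [rotate, red12]
  have hr : t4 a (3*a) (3*a) b n = t4 (3*a) a (3*a) b n := by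
    unfold t4
    apply param_aux _ _ (fun v : ℤ × ℤ × ℤ × ℤ => (v.2.1, v.1, v.2.2.1, v.2.2.2)) id
    · rintro ⟨x, y, z, w⟩ ⟨x', y', z', w'⟩ h
      simp at h ⊢; tauto
    · exact fun _ _ h => h
    · rintro ⟨x, y, z, w⟩
      simp only [Set.mem_ofPred_eq, id]
      constructor <;> intro h <;> rw [h] <;> ring
    · rintro ⟨x, y, z, w⟩ _; exact ⟨(y, x, z, w), rfl⟩
    · rintro s _; exact ⟨s, rfl⟩
  rw [hr, red23, ← mul_assoc]; congr 1
  apply param_aux _ _ (fun v : ℤ × ℤ × ℤ × ℤ => (2 * v.2.2.1 + 3 * v.1 - v.2.1,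
    2 * v.2.2.1 - v.1 - v.2.1, 2 * v.2.2.1 + v.1 + 3 * v.2.1 - 2, v.2.2.2))
    (fun v : ℤ × ℤ × ℤ × ℤ => (v.2.1, v.2.2.1 + 2 * v.1, v.2.2.1, v.2.2.2))
  · rintro ⟨x, y, z, w⟩ ⟨x', y', z', w'⟩ h
    simp only [Prod.mk.injEq] at h ⊢; omega
  · rintro ⟨x, y, z, w⟩ ⟨x', y', z', w'⟩ h
    simp only [Prod.mk.injEq] at h ⊢; omega
  · rintro ⟨x, y, z, w⟩
    simp only [Set.mem_ofPred_eq]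
    constructor
    · rintro ⟨h, -⟩; exact ⟨by linarith, by omega⟩
    · rintro ⟨h, -⟩; exact ⟨by linarith, by omega⟩
  · rintro ⟨x, y, z, w⟩ ⟨h, h2⟩
    simp only at h h2
    obtain ⟨q, hq⟩ := dvd16 a b n (3*(x*(x-1))+3*(y*(y-1))+2*(z*(z-1))) 6 w hao (by linarith)
    obtain ⟨k, hk⟩ : ∃ k, x + y = 2 * z + 4 * k := ⟨(x + y - 2 * z) / 4, by omega⟩
    obtain ⟨d, hd⟩ : ∃ d, x = z + 2 * k + d := ⟨x - z - 2 * k, by omega⟩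
    obtain rfl : y = z + 2 * k - d := by omega
    subst hd
    obtain ⟨z1, hz1⟩ := par_s15 z
    obtain ⟨d1, hd1⟩ := sqpar d
    have hq2 : 8*(z*(z-1))+24*(k*k)+24*(z*k)+6*(d*d)-12*k = 12 + 16*q := by linarith
    obtain ⟨e, rfl⟩ : ∃ e, d = 2 * e := ⟨d / 2, by omega⟩
    have hq3 : 8*(z*(z-1))+24*(k*k)+24*(z*k)+24*(e*e)-12*k = 12 + 16*q := by linarith
    obtain ⟨j, rfl⟩ : ∃ j, k = 2 * j - 1 := ⟨(k + 1) / 2, by omega⟩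
    obtain ⟨e1, he1⟩ := sqpar e
    have hq4 : 8*(z*(z-1))+24*(4*(j*j)-4*j+1)+48*(z*j)-24*z+24*(e*e)-24*j+12 = 12 + 16*q := by
      linarith
    have : (z + j + e) % 2 = 1 := by omega
    refine ⟨(e, 1 - j, (z - e + 3 * j - 1) / 2, w), ?_⟩
    simp only [Prod.mk.injEq, and_true, true_and]
    omega
  · rintro ⟨x, y, z, w⟩ ⟨h, h2⟩
    simp only at h2
    refine ⟨((y - z) / 2, x, z, w), ?_⟩
    simp only [Prod.mk.injEq, and_true, true_and]
    omega

theorem stmt15 (a b n : ℤ) (ha : 0 < a) (hao : Odd a) (hb : 0 < b) (hn : 0 ≤ n) :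
    t4 a a (6*a) (8*b) (8*n + 6*a) = 4 * t4 (2*a) (2*a) (3*a) b n ∧
    t4 a a (6*a) (8*b) (8*n + 4*a) = 2 * t4 a a (3*a) b n ∧
    t4 (2*a) (3*a) (3*a) (8*b) (8*n + 12*a) = 4 * t4 a (6*a) (6*a) b n ∧
    t4 (2*a) (3*a) (3*a) (8*b) (8*n + 6*a) = 2 * t4 a (3*a) (3*a) b n :=
  ⟨case1 a b n hao, case2 a b n hao, case3 a b n hao, case4 a b n hao⟩
end

section
/- For every positive integer n with n ≡ 5 or 7 (mod 8), N(1,1,1,6; 4n) = 5*N(1,1,1,6; n) and N(2,3,3,3; 4n) = 5*N(2,3,3,3; n). -/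
namespace Aux19

/-- Sign attached to a Boolean. -/
def sg (e : Bool) : ℤ := if e then 1 else -1

/-- Solutions of `n = a (x² + y² + z²) + b w²`. -/
def S (a b n : ℤ) : Set (ℤ × ℤ × ℤ × ℤ) :=
  {v | n = a * v.1 ^ 2 + a * v.2.1 ^ 2 + a * v.2.2.1 ^ 2 + b * v.2.2.2 ^ 2}

/-- The half inner product with `(s, t; 1)`. -/
def kk (a b s t x y w : ℤ) : ℤ := (a * (s * x + t * y) + b * w) / 2

/-- Doubled reflections in vectors of norm 8. -/
def f (a b : ℤ) (v : ℤ × ℤ × ℤ × ℤ) : Option (Bool × Bool) → ℤ × ℤ × ℤ × ℤ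
  | none => (2 * v.1, 2 * v.2.1, 2 * v.2.2.1, 2 * v.2.2.2)
  | some (e1, e2) =>
    if v.2.2.1 % 2 = 1 then
      let k := kk a b (sg e1) (sg e2) v.1 v.2.1 v.2.2.2
      (2 * v.1 - k * sg e1, 2 * v.2.1 - k * sg e2, 2 * v.2.2.1, 2 * v.2.2.2 - k)
    else if v.2.1 % 2 = 1 then
      let k := kk a b (sg e1) (sg e2) v.1 v.2.2.1 v.2.2.2
      (2 * v.1 - k * sg e1, 2 * v.2.1, 2 * v.2.2.1 - k * sg e2, 2 * v.2.2.2 - k)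
    else
      let k := kk a b (sg e1) (sg e2) v.2.1 v.2.2.1 v.2.2.2
      (2 * v.1, 2 * v.2.1 - k * sg e1, 2 * v.2.2.1 - k * sg e2, 2 * v.2.2.2 - k)

lemma sq8 (x : ℤ) : (x % 4 = 0 ∧ x ^ 2 % 8 = 0) ∨ (x % 4 = 2 ∧ x ^ 2 % 8 = 4) ∨
    (x % 2 = 1 ∧ x ^ 2 % 8 = 1) := by
  have h : x % 8 = 0 ∨ x % 8 = 1 ∨ x % 8 = 2 ∨ x % 8 = 3 ∨ x % 8 = 4 ∨ x % 8 = 5 ∨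
    x % 8 = 6 ∨ x % 8 = 7 := by omega
  rcases h with h | h | h | h | h | h | h | h <;> simp [pow_two, Int.mul_emod, h] <;> omega

/-- `z` odd, `x`, `y` even, with the half sum condition. -/
def T (x y z w : ℤ) : Prop := z % 2 = 1 ∧ x % 2 = 0 ∧ y % 2 = 0 ∧ (x + y + 2 * w) % 4 = 2

/-- `x`, `y`, `w` odd, `z` twice odd. -/
def U (x y z w : ℤ) : Prop := z % 4 = 2 ∧ x % 2 = 1 ∧ y % 2 = 1 ∧ w % 2 = 1

lemma decN : ∀ a ∈ [1, 3], ∀ p ∈ [0, 4, 1], ∀ q ∈ [0, 4, 1], ∀ r ∈ [0, 4, 1], ∀ s ∈ [0, 4, 1],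
    ((a * p + a * q + a * r + (8 - 2 * a) * s) % 8 = 5 ∨
      (a * p + a * q + a * r + (8 - 2 * a) * s) % 8 = 7) →
    (r = 1 ∧ p ≠ 1 ∧ q ≠ 1 ∧ (p + q + 4 * s) % 8 = 4) ∨
    (q = 1 ∧ p ≠ 1 ∧ r ≠ 1 ∧ (p + r + 4 * s) % 8 = 4) ∨
    (p = 1 ∧ q ≠ 1 ∧ r ≠ 1 ∧ (q + r + 4 * s) % 8 = (4 : ℤ)) := by decide

lemma dec4 : ∀ a ∈ [1, 3], ∀ p ∈ [0, 4, 1], ∀ q ∈ [0, 4, 1], ∀ r ∈ [0, 4, 1], ∀ s ∈ [0, 4, 1],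
    (a * p + a * q + a * r + (8 - 2 * a) * s) % 8 = 4 →
    (p ≠ 1 ∧ q ≠ 1 ∧ r ≠ 1 ∧ s ≠ 1) ∨
    (r = 4 ∧ p = 1 ∧ q = 1 ∧ s = 1) ∨
    (q = 4 ∧ p = 1 ∧ r = 1 ∧ s = 1) ∨
    (p = 4 ∧ q = 1 ∧ r = 1 ∧ s = (1 : ℤ)) := by decide

lemma sq_mem (x : ℤ) : x ^ 2 % 8 ∈ [(0 : ℤ), 4, 1] := by
  have := sq8 x
  simp only [List.mem_cons, List.not_mem_nil, or_false]
  omega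

lemma sq_one {x : ℤ} : x ^ 2 % 8 = 1 ↔ x % 2 = 1 := by have := sq8 x; omega

lemma T_of {x y z w : ℤ} (h1 : z ^ 2 % 8 = 1) (h2 : x ^ 2 % 8 ≠ 1) (h3 : y ^ 2 % 8 ≠ 1)
    (h4 : (x ^ 2 % 8 + y ^ 2 % 8 + 4 * (w ^ 2 % 8)) % 8 = 4) : T x y z w := by
  unfold T
  have hz := sq_one.1 h1
  have hw := sq8 w
  have hx : x ^ 2 % 8 = 2 * (x % 4) := by have := sq8 x; omega
  have hy : y ^ 2 % 8 = 2 * (y % 4) := by have := sq8 y; omega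
  rw [Ne, sq_one] at h2 h3
  rw [hx, hy] at h4
  refine ⟨hz, by omega, by omega, ?_⟩
  rcases hw with hw | hw | hw <;> rw [hw.2] at h4 <;> omega

lemma mod_id {a b x y z w : ℤ} (hab : (a = 1 ∧ b = 6) ∨ (a = 3 ∧ b = 2)) :
    (a * (x ^ 2 % 8) + a * (y ^ 2 % 8) + a * (z ^ 2 % 8) + (8 - 2 * a) * (w ^ 2 % 8)) % 8 =
    (a * x ^ 2 + a * y ^ 2 + a * z ^ 2 + b * w ^ 2) % 8 := by
  rcases hab with ⟨rfl, rfl⟩ | ⟨rfl, rfl⟩ <;> omega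

lemma mem_a {a b : ℤ} (hab : (a = 1 ∧ b = 6) ∨ (a = 3 ∧ b = 2)) : a ∈ [(1 : ℤ), 3] := by
  rcases hab with ⟨rfl, rfl⟩ | ⟨rfl, rfl⟩ <;> simp

lemma parN {a b n x y z w : ℤ} (hab : (a = 1 ∧ b = 6) ∨ (a = 3 ∧ b = 2))
    (hmod : n % 8 = 5 ∨ n % 8 = 7)
    (h : n = a * x ^ 2 + a * y ^ 2 + a * z ^ 2 + b * w ^ 2) :
    T x y z w ∨ T x z y w ∨ T y z x w := by
  rw [h, ← mod_id hab] at hmod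
  rcases decN a (mem_a hab) _ (sq_mem x) _ (sq_mem y) _ (sq_mem z) _ (sq_mem w) hmod with
    ⟨h1, h2, h3, h4⟩ | ⟨h1, h2, h3, h4⟩ | ⟨h1, h2, h3, h4⟩
  · exact Or.inl (T_of h1 h2 h3 h4)
  · exact Or.inr (Or.inl (T_of h1 h2 h3 h4))
  · exact Or.inr (Or.inr (T_of h1 h2 h3 h4))

lemma par4 {a b n x y z w : ℤ} (hab : (a = 1 ∧ b = 6) ∨ (a = 3 ∧ b = 2))
    (hmod : n % 8 = 5 ∨ n % 8 = 7)
    (h : 4 * n = a * x ^ 2 + a * y ^ 2 + a * z ^ 2 + b * w ^ 2) :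
    (x % 2 = 0 ∧ y % 2 = 0 ∧ z % 2 = 0 ∧ w % 2 = 0) ∨
    U x y z w ∨ U x z y w ∨ U y z x w := by
  have hm : (4 * n) % 8 = 4 := by omega
  rw [h, ← mod_id hab] at hm
  have e : ∀ {t : ℤ}, t ^ 2 % 8 ≠ 1 → t % 2 = 0 := by
    intro t ht
    rw [Ne, sq_one] at ht
    omega
  have e4 : ∀ {t : ℤ}, t ^ 2 % 8 = 4 → t % 4 = 2 := by
    intro t ht
    have := sq8 t
    omega
  rcases dec4 a (mem_a hab) _ (sq_mem x) _ (sq_mem y) _ (sq_mem z) _ (sq_mem w) hm with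
    ⟨h1, h2, h3, h4⟩ | ⟨h1, h2, h3, h4⟩ | ⟨h1, h2, h3, h4⟩ | ⟨h1, h2, h3, h4⟩
  · exact Or.inl ⟨e h1, e h2, e h3, e h4⟩
  · exact Or.inr (Or.inl ⟨e4 h1, sq_one.1 h2, sq_one.1 h3, sq_one.1 h4⟩)
  · exact Or.inr (Or.inr (Or.inl ⟨e4 h1, sq_one.1 h2, sq_one.1 h3, sq_one.1 h4⟩))
  · exact Or.inr (Or.inr (Or.inr ⟨e4 h1, sq_one.1 h2, sq_one.1 h3, sq_one.1 h4⟩))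

lemma kk_spec {a b x y z w : ℤ} (hab : (a = 1 ∧ b = 6) ∨ (a = 3 ∧ b = 2))
    (h : T x y z w) (e1 e2 : Bool) :
    2 * kk a b (sg e1) (sg e2) x y w = a * (sg e1 * x + sg e2 * y) + b * w ∧
    kk a b (sg e1) (sg e2) x y w % 2 = 1 := by
  unfold kk T at *
  rcases hab with ⟨rfl, rfl⟩ | ⟨rfl, rfl⟩ <;> cases e1 <;> cases e2 <;> simp [sg] <;> omega

lemma sg_sq (e : Bool) : sg e ^ 2 = 1 := by cases e <;> simp [sg]

lemma refl_eq {a b x y z w s t k : ℤ} (hab : 2 * a + b = 8) (hs : s ^ 2 = 1) (ht : t ^ 2 = 1)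
    (hk : 2 * k = a * (s * x + t * y) + b * w) :
    a * (2 * x - k * s) ^ 2 + a * (2 * y - k * t) ^ 2 + a * (2 * z) ^ 2 + b * (2 * w - k) ^ 2 =
    4 * (a * x ^ 2 + a * y ^ 2 + a * z ^ 2 + b * w ^ 2) := by
  linear_combination a * k ^ 2 * hs + a * k ^ 2 * ht + k ^ 2 * hab + 4 * k * hk

lemma f_mem {a b n : ℤ} (hab : (a = 1 ∧ b = 6) ∨ (a = 3 ∧ b = 2))
    (hmod : n % 8 = 5 ∨ n % 8 = 7) (v : ℤ × ℤ × ℤ × ℤ) (hv : v ∈ S a b n)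
    (o : Option (Bool × Bool)) : f a b v o ∈ S a b (4 * n) := by
  have hab' : 2 * a + b = 8 := by omega
  obtain ⟨x, y, z, w⟩ := v
  simp only [S, Set.mem_ofPred_eq] at hv ⊢
  rcases o with _ | ⟨e1, e2⟩
  · simp only [f]
    rw [hv]; ring
  · rcases parN hab hmod hv with h | h | h
    · have h1 := h.1
      have := refl_eq (z := z) hab' (sg_sq e1) (sg_sq e2) (kk_spec hab h e1 e2).1
      simp only [f, h1, if_true]
      linarith
    · have h1 := h.1
      have h2 : ¬ z % 2 = 1 := by have := h.2.2.1; omega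
      have := refl_eq (z := y) hab' (sg_sq e1) (sg_sq e2) (kk_spec hab h e1 e2).1
      simp only [f, h1, if_true, h2, if_false]
      linarith
    · have h1 := h.2.1
      have h2 : ¬ z % 2 = 1 := by have := h.2.2.1; omega
      have h3 : ¬ y % 2 = 1 := by omega
      have := refl_eq (z := x) hab' (sg_sq e1) (sg_sq e2) (kk_spec hab h e1 e2).1
      simp only [f, h2, h3, if_false]
      linarith

/-- The graph of the reflection. -/
def G (a b x y z w : ℤ) (e1 e2 : Bool) (X Y Z W : ℤ) : Prop :=
  T x y z w ∧ ∃ k, k % 2 = 1 ∧ 2 * k = a * (sg e1 * x + sg e2 * y) + b * w ∧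
    X = 2 * x - k * sg e1 ∧ Y = 2 * y - k * sg e2 ∧ Z = 2 * z ∧ W = 2 * w - k

lemma G_U {a b x y z w : ℤ} {e1 e2 : Bool} {X Y Z W : ℤ}
    (h : G a b x y z w e1 e2 X Y Z W) : U X Y Z W := by
  obtain ⟨hT, k, hk, hk2, h1, h2, h3, h4⟩ := h
  unfold T at hT
  unfold U
  cases e1 <;> cases e2 <;> simp only [sg] at * <;> simp at * <;> omega

lemma G_inj {a b x y z w x' y' z' w' : ℤ} {e1 e2 e1' e2' : Bool} {X Y Z W : ℤ}
    (hab : (a = 1 ∧ b = 6) ∨ (a = 3 ∧ b = 2))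
    (h : G a b x y z w e1 e2 X Y Z W) (h' : G a b x' y' z' w' e1' e2' X Y Z W) :
    x = x' ∧ y = y' ∧ z = z' ∧ w = w' ∧ e1 = e1' ∧ e2 = e2' := by
  have hU := G_U h
  obtain ⟨hT, k, hk, hk2, h1, h2, h3, h4⟩ := h
  obtain ⟨hT', k', hk', hk2', h1', h2', h3', h4'⟩ := h'
  unfold T at hT hT'
  unfold U at hU
  rcases hab with ⟨rfl, rfl⟩ | ⟨rfl, rfl⟩ <;>
  cases e1 <;> cases e2 <;> cases e1' <;> cases e2' <;> simp [sg] at * <;> omega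

set_option maxHeartbeats 2000000 in
lemma key_ex {a b X Y Z W : ℤ} (hab : (a = 1 ∧ b = 6) ∨ (a = 3 ∧ b = 2))
    (hU : U X Y Z W) : ∃ (e1 e2 : Bool), ∃ j : ℤ, j % 2 = 1 ∧
      4 * j = a * (sg e1 * X + sg e2 * Y) + b * W := by
    obtain ⟨h1, h2, h3, h4⟩ := hU
    have h : ∃ (e1 e2 : Bool), (a * (sg e1 * X + sg e2 * Y) + b * W) % 8 = 4 := by
      have hW4 : W % 4 = 1 ∨ W % 4 = 3 := by omega
      have hs : (X + Y) % 8 = 2 ∨ (X + Y) % 8 = 6 ∨ (X - Y) % 8 = 2 ∨ (X - Y) % 8 = 6 := by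
        omega
      simp only [Bool.exists_bool, sg]
      rcases hab with ⟨rfl, rfl⟩ | ⟨rfl, rfl⟩ <;> rcases hW4 with hW4 | hW4 <;>
        rcases hs with hs | hs | hs | hs <;> simp <;> omega
    obtain ⟨e1, e2, h⟩ := h
    exact ⟨e1, e2, (a * (sg e1 * X + sg e2 * Y) + b * W) / 4, by omega, by omega⟩

set_option maxHeartbeats 2000000 in
lemma G_surj {a b n X Y Z W : ℤ}
    (hab : (a = 1 ∧ b = 6) ∨ (a = 3 ∧ b = 2)) (hmod : n % 8 = 5 ∨ n % 8 = 7)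
    (hV : 4 * n = a * X ^ 2 + a * Y ^ 2 + a * Z ^ 2 + b * W ^ 2)
    (hU : U X Y Z W) : ∃ x y z w e1 e2, G a b x y z w e1 e2 X Y Z W ∧
      n = a * x ^ 2 + a * y ^ 2 + a * z ^ 2 + b * w ^ 2 := by
  have hab' : 2 * a + b = 8 := by omega
  have key := key_ex hab hU
  obtain ⟨e1, e2, j, hj, hj4⟩ := key
  have hs := sg_sq e1
  have ht := sg_sq e2
  have hso : sg e1 % 2 = 1 := by cases e1 <;> simp [sg]
  have hto : sg e2 % 2 = 1 := by cases e2 <;> simp [sg]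
  have hjs : (j * sg e1) % 2 = 1 := by rw [Int.mul_emod, hj, hso]; rfl
  have hjt : (j * sg e2) % 2 = 1 := by rw [Int.mul_emod, hj, hto]; rfl
  obtain ⟨hZ, hX, hY, hW⟩ := hU
  obtain ⟨x, hx⟩ : ∃ x, X - j * sg e1 = 2 * x := ⟨(X - j * sg e1) / 2, by omega⟩
  obtain ⟨y, hy⟩ : ∃ y, Y - j * sg e2 = 2 * y := ⟨(Y - j * sg e2) / 2, by omega⟩
  obtain ⟨z, hz⟩ : ∃ z, Z = 2 * z := ⟨Z / 2, by omega⟩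
  obtain ⟨w, hw⟩ : ∃ w, W - j = 2 * w := ⟨(W - j) / 2, by omega⟩
  have hX' : X = 2 * x - (-j) * sg e1 := by linarith
  have hY' : Y = 2 * y - (-j) * sg e2 := by linarith
  have hW' : W = 2 * w - (-j) := by linarith
  have hk : 2 * (-j) = a * (sg e1 * x + sg e2 * y) + b * w := by
    have : 2 * (2 * (-j)) = 2 * (a * (sg e1 * x + sg e2 * y) + b * w) := by
      rw [hX', hY', hW'] at hj4
      linear_combination hj4 + a * j * hs + a * j * ht + j * hab'
    linarith
  have hn : n = a * x ^ 2 + a * y ^ 2 + a * z ^ 2 + b * w ^ 2 := by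
    have := refl_eq (z := z) hab' hs ht hk
    rw [← hX', ← hY', ← hW', ← hz] at this
    linarith
  refine ⟨x, y, z, w, e1, e2, ⟨?_, -j, by omega, hk, hX', hY', hz, hW'⟩, hn⟩
  have hz1 : z % 2 = 1 := by omega
  rcases parN hab hmod hn with hp | hp | hp
  · exact hp
  · have := hp.2.2.1
    omega
  · have := hp.2.2.1
    omega

lemma f_some {a b n x y z w : ℤ} (hab : (a = 1 ∧ b = 6) ∨ (a = 3 ∧ b = 2))
    (hmod : n % 8 = 5 ∨ n % 8 = 7)
    (hv : n = a * x ^ 2 + a * y ^ 2 + a * z ^ 2 + b * w ^ 2) (e1 e2 : Bool) {X Y Z W : ℤ}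
    (hf : f a b (x, y, z, w) (some (e1, e2)) = (X, Y, Z, W)) :
    G a b x y z w e1 e2 X Y Z W ∨ G a b x z y w e1 e2 X Z Y W ∨ G a b y z x w e1 e2 Y Z X W := by
  rcases parN hab hmod hv with h | h | h
  · left
    have h1 := h.1
    have hk := kk_spec hab h e1 e2
    simp only [f, h1, if_true, Prod.mk.injEq] at hf
    exact ⟨h, _, hk.2, hk.1, hf.1.symm, hf.2.1.symm, hf.2.2.1.symm, hf.2.2.2.symm⟩
  · right; left
    have h1 := h.1
    have h2 : ¬ z % 2 = 1 := by have := h.2.2.1; omega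
    have hk := kk_spec hab h e1 e2
    simp only [f, h1, h2, if_true, if_false, Prod.mk.injEq] at hf
    exact ⟨h, _, hk.2, hk.1, hf.1.symm, hf.2.2.1.symm, hf.2.1.symm, hf.2.2.2.symm⟩
  · right; right
    have h1 := h.2.1
    have h2 : ¬ z % 2 = 1 := by have := h.2.2.1; omega
    have h3 : ¬ y % 2 = 1 := by omega
    have hk := kk_spec hab h e1 e2
    simp only [f, h3, h2, if_false, Prod.mk.injEq] at hf
    exact ⟨h, _, hk.2, hk.1, hf.2.1.symm, hf.2.2.1.symm, hf.1.symm, hf.2.2.2.symm⟩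

lemma f_of_G {a b x y z w : ℤ} {e1 e2 : Bool} {X Y Z W : ℤ} 
    (h : G a b x y z w e1 e2 X Y Z W ∨ G a b x z y w e1 e2 X Z Y W ∨
      G a b y z x w e1 e2 Y Z X W) :
    f a b (x, y, z, w) (some (e1, e2)) = (X, Y, Z, W) := by
  rcases h with ⟨⟨t1, t2, t3, t4⟩, k, -, hk, h1, h2, h3, h4⟩ |
    ⟨⟨t1, t2, t3, t4⟩, k, -, hk, h1, h2, h3, h4⟩ | ⟨⟨t1, t2, t3, t4⟩, k, -, hk, h1, h2, h3, h4⟩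
  · have hk' : kk a b (sg e1) (sg e2) x y w = k := by unfold kk; omega
    simp only [f, t1, if_true, hk', h1, h2, h3, h4]
  · have hk' : kk a b (sg e1) (sg e2) x z w = k := by unfold kk; omega
    have n2 : ¬ z % 2 = 1 := by omega
    simp only [f, t1, n2, if_true, if_false, hk', h1, h2, h3, h4]
  · have hk' : kk a b (sg e1) (sg e2) y z w = k := by unfold kk; omega
    have n2 : ¬ z % 2 = 1 := by omega
    have n3 : ¬ y % 2 = 1 := by omega
    simp only [f, n3, n2, if_false, hk', h1, h2, h3, h4]

lemma f_odd {x y z w : ℤ} {a b : ℤ} {e1 e2 : Bool} {X Y Z W : ℤ}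
    (h : G a b x y z w e1 e2 X Y Z W ∨ G a b x z y w e1 e2 X Z Y W ∨
      G a b y z x w e1 e2 Y Z X W) : W % 2 = 1 := by
  rcases h with h | h | h <;> exact (G_U h).2.2.2

lemma f_bij {a b n : ℤ} (hab : (a = 1 ∧ b = 6) ∨ (a = 3 ∧ b = 2))
    (hmod : n % 8 = 5 ∨ n % 8 = 7) :
    Function.Bijective (fun p : S a b n × Option (Bool × Bool) =>
      (⟨f a b p.1.1 p.2, f_mem hab hmod p.1.1 p.1.2 p.2⟩ : S a b (4 * n))) := by
  constructor
  · rintro ⟨⟨⟨x, y, z, w⟩, hv⟩, o⟩ ⟨⟨⟨x', y', z', w'⟩, hv'⟩, o'⟩ h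
    simp only [Subtype.mk.injEq] at h
    simp only [S, Set.mem_ofPred_eq] at hv hv'
    rcases o with _ | ⟨e1, e2⟩ <;> rcases o' with _ | ⟨e1', e2'⟩
    · simp only [f, Prod.mk.injEq] at h
      obtain ⟨h1, h2, h3, h4⟩ := h
      obtain rfl : x = x' := by omega
      obtain rfl : y = y' := by omega
      obtain rfl : z = z' := by omega
      obtain rfl : w = w' := by omega
      rfl
    · have := f_odd (f_some hab hmod hv' e1' e2' h.symm)
      simp only at this
      omega
    · have := f_odd (f_some hab hmod hv e1 e2 h)
      simp only at this
      omega
    · obtain ⟨⟨X, Y, Z, W⟩, hV⟩ : ∃ V, f a b (x', y', z', w') (some (e1', e2')) = V := ⟨_, rfl⟩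
      rw [hV] at h
      have A := f_some hab hmod hv e1 e2 h
      have B := f_some hab hmod hv' e1' e2' hV
      have goal : x = x' ∧ y = y' ∧ z = z' ∧ w = w' ∧ e1 = e1' ∧ e2 = e2' := by
        rcases A with A | A | A <;> rcases B with B | B | B <;>
        first
        | (have := G_inj hab A B; tauto)
        | (exfalso; have a1 := G_U A; have b1 := G_U B; unfold U at a1 b1; omega)
      obtain ⟨rfl, rfl, rfl, rfl, rfl, rfl⟩ := goal
      rfl
  · rintro ⟨⟨X, Y, Z, W⟩, hV⟩
    have hV' := hV
    simp only [S, Set.mem_ofPred_eq] at hV'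
    rcases par4 hab hmod hV' with ⟨h1, h2, h3, h4⟩ | h | h | h
    · obtain ⟨x, rfl⟩ : ∃ x, X = 2 * x := ⟨X / 2, by omega⟩
      obtain ⟨y, rfl⟩ : ∃ x, Y = 2 * x := ⟨Y / 2, by omega⟩
      obtain ⟨z, rfl⟩ : ∃ x, Z = 2 * x := ⟨Z / 2, by omega⟩
      obtain ⟨w, rfl⟩ : ∃ x, W = 2 * x := ⟨W / 2, by omega⟩
      refine ⟨⟨⟨(x, y, z, w), ?_⟩, none⟩, rfl⟩
      simp only [S, Set.mem_ofPred_eq]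
      linarith
    · obtain ⟨x, y, z, w, e1, e2, hG, hn⟩ := G_surj hab hmod hV' h
      exact ⟨⟨⟨(x, y, z, w), hn⟩, some (e1, e2)⟩, Subtype.ext (f_of_G (Or.inl hG))⟩
    · obtain ⟨x, z, y, w, e1, e2, hG, hn⟩ := G_surj hab hmod (by linarith) h
      exact ⟨⟨⟨(x, y, z, w), by simp only [S, Set.mem_ofPred_eq]; linarith⟩, some (e1, e2)⟩,
        Subtype.ext (f_of_G (Or.inr (Or.inl hG)))⟩
    · obtain ⟨y, z, x, w, e1, e2, hG, hn⟩ := G_surj hab hmod (by linarith) h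
      exact ⟨⟨⟨(x, y, z, w), by simp only [S, Set.mem_ofPred_eq]; linarith⟩, some (e1, e2)⟩,
        Subtype.ext (f_of_G (Or.inr (Or.inr hG)))⟩

lemma card_S {a b n : ℤ} (hab : (a = 1 ∧ b = 6) ∨ (a = 3 ∧ b = 2))
    (hmod : n % 8 = 5 ∨ n % 8 = 7) : (S a b (4 * n)).ncard = 5 * (S a b n).ncard := by
  have h := Nat.card_congr (Equiv.ofBijective _ (f_bij hab hmod))
  rw [Nat.card_prod] at h
  have h5 : Nat.card (Option (Bool × Bool)) = 5 := by simp
  rw [h5, Nat.card_coe_set_eq, Nat.card_coe_set_eq] at h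
  omega

lemma N4_two (n : ℤ) : N4 2 3 3 3 n = (S 3 2 n).ncard := by
  unfold N4
  rw [← Nat.card_coe_set_eq, ← Nat.card_coe_set_eq]
  refine Nat.card_congr ⟨fun v => ⟨(v.1.2.1, v.1.2.2.1, v.1.2.2.2, v.1.1), ?_⟩,
    fun v => ⟨(v.1.2.2.2, v.1.1, v.1.2.1, v.1.2.2.1), ?_⟩, fun v => rfl, fun v => rfl⟩
  · have := v.2
    simp only [S, Set.mem_ofPred_eq] at this ⊢
    linarith
  · have := v.2
    simp only [S, Set.mem_ofPred_eq] at this ⊢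
    linarith

end Aux19

theorem stmt19 (n : ℤ) (hn : 0 < n) (hmod : n % 8 = 5 ∨ n % 8 = 7) :
    N4 1 1 1 6 (4*n) = 5 * N4 1 1 1 6 n ∧
    N4 2 3 3 3 (4*n) = 5 * N4 2 3 3 3 n := by
  refine ⟨Aux19.card_S (a := 1) (b := 6) (by simp) hmod, ?_⟩
  rw [Aux19.N4_two, Aux19.N4_two]
  exact Aux19.card_S (by simp) hmod
end
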